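/- Every power-associative CC-loop satisfies E_x⁶ = I for all x: applying the map y ↦ (y·x)·(x\1) six times to any element y returns y. -/

import Mathlib

/-- A loop: a type with multiplication, identity, and two-sided division. -/
class Loop (Q : Type*) extends Mul Q, One Q where
  ld : Q → Q → Q  -- left division: `ld x y = x \ y`
  rd : Q → Q → Q  -- right division: `rd x y = x / y`
  one_mul : ∀ x : Q, 1 * x = x
  mul_one : ∀ x : Q, x * 1 = x
  mul_ld : ∀ x y : Q, x * ld x y = y
  ld_mul : ∀ x y : Q, ld x (x * y) = y
  rd_mul : ∀ x y : Q, rd x y * y = x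
  mul_rd : ∀ x y : Q, rd (x * y) y = x

namespace Loop

variable {Q : Type*} [Loop Q]

/-- A conjugacy closed loop (CC-loop). -/
def IsCC (Q : Type*) [Loop Q] : Prop :=
  (∀ x y z : Q, x * (y * z) = rd (x * y) x * (x * z)) ∧
  (∀ x y z : Q, (z * y) * x = (z * x) * ld x (y * x))

/-- The nucleus `N(Q)`. -/
def nucleus (Q : Type*) [Loop Q] : Set Q :=
  {a | (∀ x y : Q, a * (x * y) = (a * x) * y) ∧
       (∀ x y : Q, x * (a * y) = (x * a) * y) ∧
       (∀ x y : Q, x * (y * a) = (x * y) * a)}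

/-- A subloop: contains 1 and is closed under `·`, `\`, `/`. -/
def IsSubloop (S : Set Q) : Prop :=
  (1 : Q) ∈ S ∧ (∀ a ∈ S, ∀ b ∈ S, a * b ∈ S) ∧
  (∀ a ∈ S, ∀ b ∈ S, ld a b ∈ S) ∧ (∀ a ∈ S, ∀ b ∈ S, rd a b ∈ S)

/-- The subloop generated by a set `S`. -/
def closure (S : Set Q) : Set Q := ⋂₀ {T : Set Q | IsSubloop T ∧ S ⊆ T}

/-- An element is power-associative if the subloop it generates is associative. -/
def IsPA (a : Q) : Prop :=
  ∀ x ∈ closure {a}, ∀ y ∈ closure {a}, ∀ z ∈ closure {a}, x * (y * z) = (x * y) * z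

/-- Powers: `pow a 0 = 1`, `pow a (n+1) = a * pow a n`. -/
def pow (a : Q) : ℕ → Q
  | 0 => 1
  | n + 1 => a * pow a n

/-- A WIP (weak inverse property) element. -/
def IsWIP (c : Q) : Prop := ∀ x : Q, c * ld (x * c) 1 = ld x 1

end Loop

open Loop

namespace Loop

theorem abs_main {Q M : Type*} [Mul Q] [One Q] [AddCommGroup M] (t : Q → M →+ M)
    (f : Q → Q → Q → M)
    (s1 : ∀ x y z, f x y z = f y x z) (s2 : ∀ x y z, f x y z = f x z y)
    (comm : ∀ x y z w, f (x * y) z w = f (y * x) z w)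
    (pent : ∀ x y z w, f x y (z * w) + f (x * y) z w =
      t x (f y z w) + f x (y * z) w + f x y z)
    (diag : ∀ x, f x x x = 0) (f1 : ∀ x y, f x y 1 = 0)
    (inv : Q → Q) (hinv : ∀ x, x * inv x = 1)
    (tinv2 : ∀ x m, t (inv x) (t x m) = m)
    (x y : Q) : f y x (inv x) = - f y x x ∧ f y x x + f y x x + f y x x + f y x x + f y x x
      + f y x x = 0 := by
  have s3 : ∀ x y z, f x y z = f z x y := fun x y z => by rw [s2, s1]
  have tinj : ∀ x m n, t x m = t x n → m = n := fun x m n h => by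
    rw [← tinv2 x m, h, tinv2]
  have comm3 : ∀ x y z w, f z w (x * y) = f z w (y * x) := fun x y z w => by
    rw [s3, comm, s3 z]
  have tri : ∀ x y z w, f y z (x * w) = f y z x + t x (f y z w) := fun x y z w => by
    have H1 := pent x y w z
    have H2 := pent x w y z
    have H3 := pent x y z w
    rw [comm3 w z, s1 (x * y) w z, s2 w (x * y) z, s1 w z (x * y), s2 y w z, s2 x (y * w) z] at H1
    rw [← s3 y z (x * w), s1 w y z, s2 y w z, s2 x (w * y) z, comm3 w y, s2 x w y] at H2
    rw [← s3 z w (x * y), s2 x (y * z) w] at H3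
    rw [s3 y z x]
    have : f x w (y * z) + f y z (x * w) = t x (f y z w) + f x w (y * z) + f x y z := by
      rw [H2, ← H1, H3]
    have h := sub_eq_zero.2 this
    apply sub_eq_zero.1
    rw [← h]; abel
  have tri2 : ∀ x y z w, f y (x * w) z = f y x z + t x (f y w z) := fun x y z w => by
    rw [s2, tri, s2 y z, s2 y z]
  have tri1 : ∀ x y z w, f (x * w) y z = f x y z + t x (f w y z) := fun x y z w => by
    rw [s1, tri2, s1 y, s1 y]
  have fix : ∀ x y, t x (f x x y) = f x x y := fun x y => by
    have h := comm3 x y x x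
    rw [tri, tri, diag, map_zero] at h
    simpa using h
  have pol : ∀ x y, f x x y + f x x y + f x x y + (f y y x + f y y x + f y y x) = 0 := fun x y => by
    have h := diag (x * y)
    simp only [tri, tri1, tri2, map_add, diag, map_zero] at h
    rw [← s3 x x y, s2 x y x, s2 y x y, ← s3 y y x] at h
    rw [fix x y] at h
    apply tinj x
    apply tinj x
    simp only [map_add, fix x y, map_zero]
    rw [← h]; abel
  have fix' : ∀ x y, t x (f y x x) = f y x x := fun x y => by
    rw [s3, s3]; exact fix x y
  have A : ∀ x y, f y x (inv x) = - f y x x := fun x y => by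
    have h := f1 y x
    rw [← hinv x, tri] at h
    apply tinj x
    rw [map_neg, fix']
    exact (neg_eq_of_add_eq_zero_right h).symm
  refine ⟨A x y, ?_⟩
  have B : f y (inv x) (inv x) = f y x x := by
    have h := f1 y (inv x)
    rw [← hinv x, tri, s2 y (inv x) x, A] at h
    apply tinj x
    rw [fix', ← neg_eq_of_add_eq_zero_right h, neg_neg]
  have C : t x (f y y (inv x)) = - f y y x := by
    have h := f1 y y
    rw [← hinv x, tri] at h
    exact (neg_eq_of_add_eq_zero_right h).symm
  have p1 := pol x y
  have p2 := pol (inv x) y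
  rw [s3 (inv x) (inv x) y, B] at p2
  have p3 := congrArg (t x) p2
  simp only [map_add, fix', C, map_zero] at p3
  rw [s3 x x y] at p1
  have := congrArg₂ (· + ·) p1 p3
  simp only [add_zero] at this
  rw [← this]; abel

variable {Q : Type*} [Loop Q]

theorem rcan {a b c : Q} (h : a * c = b * c) : a = b := by
  rw [← mul_rd a c, h, mul_rd]

theorem lcan {a b c : Q} (h : c * a = c * b) : a = b := by
  rw [← ld_mul c a, h, ld_mul]

def Lp (x : Q) : Equiv.Perm Q := ⟨fun y => x * y, fun y => ld x y, ld_mul x, mul_ld x⟩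
def Rp (x : Q) : Equiv.Perm Q :=
  ⟨fun y => y * x, fun y => rd y x, fun y => mul_rd y x, fun y => rd_mul y x⟩

def Aut (a b c : Equiv.Perm Q) : Prop := ∀ u v, a u * b v = c (u * v)

theorem Aut.mul {a b c a' b' c' : Equiv.Perm Q} (h : Aut a b c) (h' : Aut a' b' c') :
    Aut (a * a') (b * b') (c * c') := fun u v => by
  simp only [Equiv.Perm.mul_apply]; rw [h, h']

theorem Aut.inv {a b c : Equiv.Perm Q} (h : Aut a b c) : Aut a⁻¹ b⁻¹ c⁻¹ := fun u v => by
  apply c.injective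
  rw [← h]; simp

theorem autA (hcc : IsCC Q) (x : Q) : Aut ((Rp x)⁻¹ * Lp x) (Lp x) (Lp x) := fun u v =>
  (hcc.1 x u v).symm

theorem autB (hcc : IsCC Q) (x : Q) : Aut (Rp x) ((Lp x)⁻¹ * Rp x) (Rp x) := fun u v =>
  (hcc.2 x v u).symm

theorem mid_nuc (hcc : IsCC Q) {b : Q} (h : ∀ u w : Q, u * (b * w) = (u * b) * w) :
    b ∈ nucleus Q := by
  refine ⟨fun y z => ?_, h, fun z y => ?_⟩
  · rw [hcc.1 b y z, h, rd_mul]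
  · rw [hcc.2 b y z, ← h, mul_ld]

theorem left_nuc (hcc : IsCC Q) {a : Q} (h : ∀ u w : Q, a * (u * w) = (a * u) * w) :
    a ∈ nucleus Q := by
  refine mid_nuc hcc fun u w => ?_
  have := hcc.1 a (ld a (u * a)) w
  rw [h, mul_ld, mul_rd] at this
  exact this.symm

theorem right_nuc (hcc : IsCC Q) {a : Q} (h : ∀ u w : Q, u * (w * a) = (u * w) * a) :
    a ∈ nucleus Q := by
  refine mid_nuc hcc fun u w => ?_
  have := hcc.2 a (rd (a * w) a) u
  rw [← h, rd_mul, ld_mul] at this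
  exact this

/-- conjugation -/
def T (x k : Q) : Q := rd (x * k) x

theorem T_mul (x k : Q) : T x k * x = x * k := rd_mul _ _

theorem T_eq {x k k' : Q} (h : k' * x = x * k) : T x k = k' := by
  rw [T, ← h, mul_rd]

theorem LL (hcc : IsCC Q) (x y z : Q) : x * (y * z) = T x y * (x * z) := hcc.1 x y z

theorem T_nuc (hcc : IsCC Q) (x : Q) {k : Q} (hk : k ∈ nucleus Q) : T x k ∈ nucleus Q := by
  have key : ∀ y z, T x k * (T x y * (x * z)) = T x (k * y) * (x * z) := fun y z => by
    rw [← LL hcc, ← LL hcc, ← LL hcc, hk.1]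
  have key2 : ∀ y, T x k * T x y = T x (k * y) := fun y => by
    have := key y (ld x 1)
    rwa [mul_ld, mul_one, mul_one] at this
  apply left_nuc hcc
  intro u w
  have := key (ld x (u * x)) (ld x w)
  rw [← key2, mul_ld] at this
  rwa [show T x (ld x (u * x)) = u from T_eq (by rw [mul_ld])] at this

theorem T'_nuc (hcc : IsCC Q) (x : Q) {k : Q} (hk : k ∈ nucleus Q) :
    ld x (k * x) ∈ nucleus Q := by
  have RR : ∀ y z : Q, (z * y) * x = (z * x) * ld x (y * x) := fun y z => hcc.2 x y z
  have key : ∀ y z, (z * x * ld x (y * x)) * ld x (k * x) = (z * x) * ld x ((y * k) * x) :=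
    fun y z => by
      rw [← RR, ← RR, ← RR, hk.2.2]
  have key2 : ∀ y, ld x (y * x) * ld x (k * x) = ld x ((y * k) * x) := fun y => by
    have := key y (rd 1 x)
    rwa [rd_mul, one_mul, one_mul] at this
  apply right_nuc hcc
  intro u w
  have := key (rd (x * w) x) (rd u x)
  rw [← key2, rd_mul, rd_mul, ld_mul] at this
  exact this.symm

theorem comm_nuc (hcc : IsCC Q) (x y : Q) : ∃ n ∈ nucleus Q, T x y = n * y := by
  obtain ⟨w, rfl⟩ : ∃ w, y = x * w := ⟨ld x y, (mul_ld x y).symm⟩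
  set y := x * w with hy
  have h1 : ∀ v, Lp x * Rp v = Rp (x * v) * (Rp x)⁻¹ * Lp x := fun v => by
    ext z; exact hcc.1 x z v
  set φ := Rp (ld x 1) * (Rp w)⁻¹ * Rp y with hφ
  have hR1 : Rp (1 : Q) = 1 := by ext z; exact mul_one z
  have e : φ = (Lp x)⁻¹ * (Rp y)⁻¹ * Lp x * Rp y := by
    have e1 := h1 (ld x 1)
    have e2 := h1 w
    rw [mul_ld, hR1, _root_.one_mul] at e1
    rw [_root_.mul_assoc, ← e1, ← hy] at e2
    have : Lp x * Rp (ld x 1) * (Rp w)⁻¹ = (Rp y)⁻¹ * Lp x := by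
      rw [eq_inv_mul_iff_mul_eq, ← _root_.mul_assoc, ← e2]; group
    rw [hφ, _root_.mul_assoc (Lp x)⁻¹, ← this]; group
  have ha := ((autB hcc (ld x 1)).mul (autB hcc w).inv).mul (autB hcc y)
  rw [← hφ] at ha
  have φ1 : φ 1 = 1 := by
    change (rd (1 * y) w) * ld x 1 = 1
    rw [one_mul, hy, mul_rd, mul_ld]
  have aut : Aut φ φ φ := by
    intro u v
    have := ha 1 v
    rw [φ1, one_mul, one_mul] at this
    rw [← this]; exact ha u v
  have C := ((((autA hcc x).inv.mul (autB hcc y).inv).mul (autA hcc x)).mul (autB hcc y)).mul aut.inv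
  rw [← e, mul_inv_cancel] at C
  set α := ((Rp x)⁻¹ * Lp x)⁻¹ * (Rp y)⁻¹ * ((Rp x)⁻¹ * Lp x) * Rp y * φ⁻¹ with hα
  generalize ((Lp x)⁻¹ * ((Lp y)⁻¹ * Rp y)⁻¹ * Lp x * ((Lp y)⁻¹ * Rp y) * φ⁻¹) = β at C
  have C' : ∀ u v, α u * β v = u * v := C
  have hb : ∀ u, α u * β 1 = u := fun u => by rw [C', mul_one]
  have hb2 : ∀ v, α 1 * β v = v := fun v => by rw [C', one_mul]
  have hN : α 1 ∈ nucleus Q := by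
    have c1 : ∀ p, α (p * β 1) = p := fun p => rcan (hb (p * β 1))
    have c2 : ∀ q, β (α 1 * q) = q := fun q => lcan (hb2 (α 1 * q))
    have c3 : ∀ p q, p * q = (p * β 1) * (α 1 * q) := fun p q => by
      rw [← C' (p * β 1), c1, c2]
    have c4 : ∀ p, (p * α 1) * β 1 = p := fun p => by
      apply rcan (c := α 1)
      have := c3 (p * α 1) 1
      rw [mul_one, mul_one] at this
      exact this.symm
    apply mid_nuc hcc
    intro u v
    rw [c3 (u * α 1), c4]
  have hα1 : α 1 = ld x (rd (T x y) y * x) := by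
    have : φ⁻¹ 1 = 1 := by rw [Equiv.Perm.inv_eq_iff_eq, φ1]
    rw [hα, Equiv.Perm.mul_apply, this]
    change ld x ((rd (T x (1 * y)) y) * x) = _
    rw [one_mul]
  refine ⟨rd (T x y) y, ?_, (rd_mul _ _).symm⟩
  have := T_nuc hcc x hN
  rwa [hα1, T_eq (k' := rd (T x y) y) (by rw [mul_ld])] at this

theorem nuc_one : (1 : Q) ∈ nucleus Q :=
  ⟨fun x y => by rw [one_mul, one_mul], fun x y => by rw [one_mul, mul_one],
    fun x y => by rw [mul_one, mul_one]⟩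

theorem nuc_mul {k m : Q} (hk : k ∈ nucleus Q) (hm : m ∈ nucleus Q) : k * m ∈ nucleus Q :=
  ⟨fun x y => by rw [← hk.1, hm.1, hk.1, hk.1],
    fun x y => by rw [← hk.1, hk.2.1, hm.2.1, ← hk.2.1],
    fun x y => by rw [hk.2.1, hm.2.2, hk.2.2, ← hk.2.1]⟩

theorem nuc_inv_mul {k : Q} (hk : k ∈ nucleus Q) : ld k 1 * k = 1 := by
  apply lcan (c := k)
  rw [hk.1, mul_ld, one_mul, mul_one]

theorem nuc_inv {k : Q} (hk : k ∈ nucleus Q) : ld k 1 ∈ nucleus Q := by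
  have h2 := nuc_inv_mul hk
  have h1 : ∀ x y, ld k 1 * (x * y) = (ld k 1 * x) * y := fun x y => by
    apply lcan (c := k)
    rw [hk.1, hk.1, hk.1, mul_ld, one_mul, one_mul]
  refine ⟨h1, fun x y => ?_, fun x y => ?_⟩
  · obtain ⟨z, rfl⟩ : ∃ z, y = k * z := ⟨ld k y, (mul_ld _ _).symm⟩
    rw [h1, h2, one_mul, hk.2.1, ← hk.2.2, h2, mul_one]
  · apply rcan (c := k)
    rw [← hk.2.2, ← hk.2.2, ← hk.2.2, h2, mul_one, mul_one]

def ZN (Q : Type*) [Loop Q] : Type _ :=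
  {k : Q // k ∈ nucleus Q ∧ ∀ m ∈ nucleus Q, k * m = m * k}

theorem ZN.ext {k m : ZN Q} (h : k.1 = m.1) : k = m := Subtype.ext h

instance : Add (ZN Q) := ⟨fun k m => ⟨k.1 * m.1, nuc_mul k.2.1 m.2.1, fun n hn => by
  rw [← k.2.1.1, m.2.2 n hn, k.2.1.1, k.2.2 n hn, ← k.2.1.2.1]⟩⟩
instance : Zero (ZN Q) := ⟨⟨1, nuc_one, fun n _ => by rw [one_mul, mul_one]⟩⟩
instance : Neg (ZN Q) := ⟨fun k => ⟨ld k.1 1, nuc_inv k.2.1, fun n hn => by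
  apply lcan (c := k.1)
  rw [k.2.1.1, k.2.1.1, mul_ld, k.2.2 n hn, ← k.2.1.2.1, mul_ld, one_mul, mul_one]⟩⟩

theorem ZN.add_val (k m : ZN Q) : (k + m).1 = k.1 * m.1 := rfl
theorem ZN.zero_val : (0 : ZN Q).1 = 1 := rfl
theorem ZN.neg_val (k : ZN Q) : (-k).1 = ld k.1 1 := rfl

instance : AddCommGroup (ZN Q) where
  add_assoc a b c := ZN.ext (a.2.1.1 _ _).symm
  zero_add a := ZN.ext (one_mul _)
  add_zero a := ZN.ext (mul_one _)
  neg_add_cancel a := ZN.ext (nuc_inv_mul a.2.1)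
  add_comm a b := ZN.ext (a.2.2 _ b.2.1)
  nsmul := nsmulRec
  zsmul := zsmulRec

theorem mv {k : Q} (hcc : IsCC Q) (hk : k ∈ nucleus Q) (x y : Q) :
    x * (k * y) = T x k * (x * y) := by
  rw [hk.2.1, ← T_mul x k, ← (T_nuc hcc x hk).1]

theorem T_T {k : Q} (hcc : IsCC Q) (hk : k ∈ nucleus Q) (x y : Q) :
    T (x * y) k = T x (T y k) := by
  apply T_eq
  rw [← mv hcc (T_nuc hcc y hk), T_mul, hk.2.2]

theorem T_hom {k m : Q} (hcc : IsCC Q) (hk : k ∈ nucleus Q) (x : Q) :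
    T x (k * m) = T x k * T x m := by
  apply T_eq
  rw [← (T_nuc hcc x hk).1, T_mul, mv hcc hk]

theorem T_surj (hcc : IsCC Q) (x : Q) {m : Q} (hm : m ∈ nucleus Q) :
    ∃ k ∈ nucleus Q, T x k = m :=
  ⟨ld x (m * x), T'_nuc hcc x hm, T_eq (by rw [mul_ld])⟩

def act (hcc : IsCC Q) (x : Q) : ZN Q →+ ZN Q where
  toFun k := ⟨T x k.1, T_nuc hcc x k.2.1, fun m hm => by
    obtain ⟨n, hn, rfl⟩ := T_surj hcc x hm
    rw [← T_hom hcc k.2.1, ← T_hom hcc hn, k.2.2 n hn]⟩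
  map_zero' := ZN.ext (T_eq (by rw [ZN.zero_val, one_mul, mul_one]))
  map_add' k m := ZN.ext (T_hom hcc k.2.1 x)

theorem act_val (hcc : IsCC Q) (x : Q) (k : ZN Q) : (act hcc x k).1 = T x k.1 := rfl

theorem comm' (hcc : IsCC Q) (x y : Q) : ∃ n ∈ nucleus Q, x * y = n * (y * x) := by
  obtain ⟨n, hn, h⟩ := comm_nuc hcc x y
  exact ⟨n, hn, by rw [hn.1, ← h, T_mul]⟩

theorem asc_nuc (hcc : IsCC Q) (x y z : Q) :
    ∃ a ∈ nucleus Q, x * (y * z) = a * ((x * y) * z) := by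
  obtain ⟨n1, h1, e1⟩ := comm' hcc y z
  obtain ⟨n2, h2, e2⟩ := comm_nuc hcc x z
  obtain ⟨n3, h3, e3⟩ := comm' hcc z (x * y)
  have h1' := T_nuc hcc x h1
  refine ⟨T x n1 * (n2 * n3), nuc_mul h1' (nuc_mul h2 h3), ?_⟩
  rw [e1, mv hcc h1, LL hcc x z y, e2, ← h2.1, e3, ← h1'.1, ← h2.1]

theorem asc_cen (hcc : IsCC Q) {x y z a : Q} (ha : a ∈ nucleus Q)
    (h : x * (y * z) = a * ((x * y) * z)) {m : Q} (hm : m ∈ nucleus Q) : a * m = m * a := by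
  obtain ⟨k, hk, rfl⟩ := T_surj hcc ((x * y) * z) hm
  have e : T (x * (y * z)) k = T ((x * y) * z) k := by
    rw [T_T hcc hk, T_T hcc hk, T_T hcc hk, T_T hcc (T_nuc hcc z hk)]
  rw [h, T_T hcc hk] at e
  have := T_mul a (T ((x * y) * z) k)
  rw [e] at this
  exact this.symm

def asc (hcc : IsCC Q) (x y z : Q) : ZN Q := ⟨rd (x * (y * z)) ((x * y) * z), by
  obtain ⟨a, ha, h⟩ := asc_nuc hcc x y z
  have : rd (x * (y * z)) ((x * y) * z) = a := by rw [h, mul_rd]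
  rw [this]
  exact ⟨ha, fun m hm => asc_cen hcc ha h hm⟩⟩

theorem asc_spec (hcc : IsCC Q) (x y z : Q) :
    x * (y * z) = (asc hcc x y z).1 * ((x * y) * z) := (rd_mul _ _).symm

theorem asc_eq (hcc : IsCC Q) {x y z : Q} {a : ZN Q} (h : x * (y * z) = a.1 * ((x * y) * z)) :
    asc hcc x y z = a := by
  apply ZN.ext
  apply rcan (c := ((x * y) * z))
  rw [← h]; exact (asc_spec hcc x y z).symm

theorem ZN.swap (a : ZN Q) {n : Q} (hn : n ∈ nucleus Q) (w : Q) :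
    a.1 * (n * w) = n * (a.1 * w) := by
  rw [hn.2.1, a.2.2 n hn, ← hn.1]

theorem asc_shift (hcc : IsCC Q) {k : Q} (hk : k ∈ nucleus Q) (x y z : Q) :
    asc hcc (k * x) y z = asc hcc x y z := by
  apply asc_eq
  rw [← hk.1, ← hk.1, ← hk.1, ZN.swap _ hk, ← asc_spec]

theorem asc_s1 (hcc : IsCC Q) (x y z : Q) : asc hcc x y z = asc hcc y x z := by
  apply asc_eq
  obtain ⟨n, hn, h⟩ := comm_nuc hcc x y
  rw [LL hcc, h, ← T_mul x y, h, ← hn.1, ← hn.1, ← hn.1, ZN.swap _ hn, ← asc_spec]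

theorem asc_s2 (hcc : IsCC Q) (x y z : Q) : asc hcc x y z = asc hcc x z y := by
  apply asc_eq
  obtain ⟨n, hn, h⟩ := comm' hcc y z
  have hn' := T'_nuc hcc z hn
  have e : ld z (y * z) = ld z (n * z) * y := by
    apply lcan (c := z)
    rw [mul_ld, hn'.2.1, mul_ld, ← hn.1, h]
  rw [hcc.2 z y x, e, mv hcc hn', T_T hcc hn', T_eq (x := z) (k' := n) (by rw [mul_ld]),
    ZN.swap _ (T_nuc hcc x hn), ← asc_spec, h, mv hcc hn]

theorem asc_pent (hcc : IsCC Q) (x y z w : Q) :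
    asc hcc x y (z * w) + asc hcc (x * y) z w =
      act hcc x (asc hcc y z w) + asc hcc x (y * z) w + asc hcc x y z := by
  apply ZN.ext
  apply rcan (c := ((x * y) * z) * w)
  simp only [ZN.add_val]
  rw [← (asc hcc x y (z * w)).2.1.1, ← asc_spec, ← asc_spec]
  rw [← (nuc_mul (act hcc x (asc hcc y z w)).2.1 (asc hcc x (y * z) w).2.1).1,
    (asc hcc x y z).2.1.1, ← asc_spec, ← (act hcc x (asc hcc y z w)).2.1.1, ← asc_spec, act_val,
    ← mv hcc (asc hcc y z w).2.1, ← asc_spec]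

end Loop

/-- Every power-associative CC-loop satisfies `E_x⁶ = I`. -/
theorem stmt_18 {Q : Type*} [Loop Q] (hcc : IsCC Q) (hpa : ∀ a : Q, IsPA a) :
    ∀ x y : Q, (fun z : Q => (z * x) * ld x 1)^[6] y = y := by
  intro x y
  have mem : ∀ a : Q, a ∈ Loop.closure {a} := fun a S hS => hS.2 rfl
  have memi : ∀ a : Q, ld a 1 ∈ Loop.closure {a} := fun a S hS =>
    hS.1.2.2.1 a (hS.2 rfl) 1 hS.1.1
  have li : ∀ a : Q, ld a 1 * a = 1 := fun a => by
    apply lcan (c := a)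
    rw [hpa a a (mem a) _ (memi a) a (mem a), Loop.mul_ld, Loop.one_mul, Loop.mul_one]
  have key := abs_main (act hcc) (asc hcc) (asc_s1 hcc) (asc_s2 hcc)
    (fun x y z w => by
      obtain ⟨n, hn, h⟩ := comm' hcc x y
      rw [h, asc_shift hcc hn])
    (asc_pent hcc)
    (fun x => asc_eq hcc (by
      rw [ZN.zero_val, Loop.one_mul]
      exact hpa x x (mem x) x (mem x) x (mem x)))
    (fun x y => asc_eq hcc (by rw [ZN.zero_val, Loop.one_mul, Loop.mul_one, Loop.mul_one]))
    (fun x => ld x 1) (fun x => Loop.mul_ld x 1)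
    (fun x m => ZN.ext (by
      rw [act_val, act_val, ← T_T hcc m.2.1, li]
      exact T_eq (by rw [Loop.one_mul, Loop.mul_one]))) x y
  obtain ⟨k1, k2⟩ := key
  set c := asc hcc y x x with hc
  have E1 : (y * x) * ld x 1 = c.1 * y := by
    have h := asc_spec hcc y x (ld x 1)
    rw [k1, Loop.mul_ld, Loop.mul_one] at h
    have h2 : c.1 * y = c.1 * ((-c).1 * (y * x * ld x 1)) := congrArg (fun q => c.1 * q) h
    rw [h2, c.2.1.1, ← ZN.add_val, add_neg_cancel, ZN.zero_val, Loop.one_mul]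
  have E2 : ∀ k : Q, k ∈ nucleus Q → ((k * y) * x) * ld x 1 = (k * c.1) * y := fun k hk => by
    rw [← hk.1, ← hk.1, E1, hk.1]
  have m2 := nuc_mul c.2.1 c.2.1
  have m3 := nuc_mul m2 c.2.1
  have m4 := nuc_mul m3 c.2.1
  have m5 := nuc_mul m4 c.2.1
  have k3 := congrArg Subtype.val k2
  change ((((c.1 * c.1) * c.1) * c.1) * c.1) * c.1 = 1 at k3
  simp only [Function.iterate_succ, Function.iterate_zero, Function.comp, id]
  rw [E1, E2 _ c.2.1, E2 _ m2, E2 _ m3, E2 _ m4, E2 _ m5, k3, Loop.one_mul]
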